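/- arXiv:0903.4133 — 3 statements merged into one kernel-verified Lean document; each statement's English description precedes it below -/
import Mathlib

section
/- Let C be a C*-algebra, let G ⊆ C be a subset closed under taking adjoints (G* = G) such that the smallest closed subalgebra of C containing G is C itself, let E ⊆ C be a finite subset, and let θ > 0. Then there exist β > 0 and a finite subset G' ⊆ G such that the following holds: for every C*-algebra B, every *-homomorphism γ : C → B, and every b ∈ B with ‖b‖ ≤ 1, if ‖b·γ(g) − γ(g)·b‖ < β for all g ∈ G', then ‖b·γ(e) − γ(e)·b‖ < θ for all e ∈ E. -/
universe u v

/-- The element `x` approximately commutes with contractions that almost commute with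
finitely many elements of `G`, uniformly in the target algebra. -/
def ApproxCtrl {C : Type u} [NonUnitalCStarAlgebra C] (G : Set C) (x : C) : Prop :=
  ∀ θ : ℝ, 0 < θ → ∃ β > (0:ℝ), ∃ G' : Finset C, ↑G' ⊆ G ∧
      ∀ (B : Type v) [NonUnitalCStarAlgebra B] (γ : C →⋆ₙₐ[ℂ] B) (b : B),
        ‖b‖ ≤ 1 →
        (∀ g ∈ G', ‖b * γ g - γ g * b‖ < β) →
        ‖b * γ x - γ x * b‖ < θ

section
variable {C : Type u} [NonUnitalCStarAlgebra C] {G : Set C}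

/-- Two controlled elements can be controlled simultaneously. -/
theorem ApproxCtrl.both {x y : C} (hx : ApproxCtrl.{u, v} G x) (hy : ApproxCtrl.{u, v} G y)
    (θ : ℝ) (hθ : 0 < θ) : ∃ β > (0:ℝ), ∃ G' : Finset C, ↑G' ⊆ G ∧
      ∀ (B : Type v) [NonUnitalCStarAlgebra B] (γ : C →⋆ₙₐ[ℂ] B) (b : B),
        ‖b‖ ≤ 1 →
        (∀ g ∈ G', ‖b * γ g - γ g * b‖ < β) →
        ‖b * γ x - γ x * b‖ < θ ∧ ‖b * γ y - γ y * b‖ < θ := by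
  classical
  obtain ⟨β₁, h₁, G₁, hG₁, H₁⟩ := hx θ hθ
  obtain ⟨β₂, h₂, G₂, hG₂, H₂⟩ := hy θ hθ
  refine ⟨min β₁ β₂, lt_min h₁ h₂, G₁ ∪ G₂, by simp [hG₁, hG₂], ?_⟩
  intro B _ γ b hb h
  exact ⟨H₁ B γ b hb fun g hg =>
      (h g (Finset.mem_union_left _ hg)).trans_le (min_le_left _ _),
    H₂ B γ b hb fun g hg =>
      (h g (Finset.mem_union_right _ hg)).trans_le (min_le_right _ _)⟩

theorem ApproxCtrl.add {x y : C} (hx : ApproxCtrl.{u, v} G x) (hy : ApproxCtrl.{u, v} G y) :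
    ApproxCtrl.{u, v} G (x + y) := by
  intro θ hθ
  obtain ⟨β, h, G', hG', H⟩ := hx.both hy (θ / 2) (by positivity)
  refine ⟨β, h, G', hG', fun B _ γ b hb hg => ?_⟩
  obtain ⟨h1, h2⟩ := H B γ b hb hg
  have : b * γ (x + y) - γ (x + y) * b
      = (b * γ x - γ x * b) + (b * γ y - γ y * b) := by
    rw [map_add]; noncomm_ring
  rw [this]
  linarith [norm_add_le (b * γ x - γ x * b) (b * γ y - γ y * b)]

theorem ApproxCtrl.mul {x y : C} (hx : ApproxCtrl.{u, v} G x) (hy : ApproxCtrl.{u, v} G y) :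
    ApproxCtrl.{u, v} G (x * y) := by
  intro θ hθ
  have hM : 0 < ‖x‖ + ‖y‖ + 1 := by positivity
  obtain ⟨β, h, G', hG', H⟩ := hx.both hy (θ / (‖x‖ + ‖y‖ + 1)) (by positivity)
  refine ⟨β, h, G', hG', fun B _ γ b hb hg => ?_⟩
  obtain ⟨h1, h2⟩ := H B γ b hb hg
  have e : b * γ (x * y) - γ (x * y) * b
      = (b * γ x - γ x * b) * γ y + γ x * (b * γ y - γ y * b) := by
    rw [map_mul, sub_mul, mul_sub]; simp only [mul_assoc]; abel
  rw [e]
  set ε := θ / (‖x‖ + ‖y‖ + 1) with hε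
  have hε0 : 0 < ε := by positivity
  have hεM : ε * (‖x‖ + ‖y‖ + 1) = θ := by rw [hε]; field_simp
  have n1 : ‖γ x‖ ≤ ‖x‖ := NonUnitalStarAlgHom.norm_apply_le γ x
  have n2 : ‖γ y‖ ≤ ‖y‖ := NonUnitalStarAlgHom.norm_apply_le γ y
  calc _ ≤ ‖b * γ x - γ x * b‖ * ‖γ y‖ + ‖γ x‖ * ‖b * γ y - γ y * b‖ :=
        (norm_add_le _ _).trans (add_le_add (norm_mul_le _ _) (norm_mul_le _ _))
    _ ≤ ε * ‖y‖ + ‖x‖ * ε := by gcongr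
    _ < θ := by nlinarith

theorem ApproxCtrl.smul {x : C} (c : ℂ) (hx : ApproxCtrl.{u, v} G x) :
    ApproxCtrl.{u, v} G (c • x) := by
  intro θ hθ
  obtain ⟨β, h, G', hG', H⟩ := hx (θ / (‖c‖ + 1)) (by positivity)
  refine ⟨β, h, G', hG', fun B _ γ b hb hg => ?_⟩
  have h1 := H B γ b hb hg
  rw [map_smul, mul_smul_comm, smul_mul_assoc, ← smul_sub, norm_smul]
  rw [lt_div_iff₀ (by positivity)] at h1
  nlinarith [norm_nonneg (b * γ x - γ x * b), norm_nonneg c]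

theorem ApproxCtrl.of_mem_adjoin {x : C} (hx : x ∈ NonUnitalAlgebra.adjoin ℂ G) :
    ApproxCtrl.{u, v} G x := by
  induction hx using NonUnitalAlgebra.adjoin_induction with
  | mem x hx =>
    exact fun θ hθ => ⟨θ, hθ, {x}, by simpa using hx, fun B _ γ b _ h => h x (by simp)⟩
  | add x y _ _ hx hy => exact hx.add hy
  | zero => exact fun θ hθ => ⟨1, one_pos, ∅, by simp, fun B _ γ b _ _ => by simpa using hθ⟩
  | mul x y _ _ hx hy => exact hx.mul hy
  | smul c x _ hx => exact hx.smul c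

theorem ApproxCtrl.of_mem_closure {x : C}
    (hx : x ∈ closure (NonUnitalAlgebra.adjoin ℂ G : Set C)) :
    ApproxCtrl.{u, v} G x := by
  intro θ hθ
  obtain ⟨y, hy, hxy⟩ := Metric.mem_closure_iff.1 hx (θ / 4) (by positivity)
  obtain ⟨β, h, G', hG', H⟩ := ApproxCtrl.of_mem_adjoin.{u, v} hy (θ / 2) (by positivity)
  refine ⟨β, h, G', hG', fun B _ γ b hb hg => ?_⟩
  have h1 := H B γ b hb hg
  rw [dist_eq_norm] at hxy
  have n1 : ‖γ (x - y)‖ ≤ ‖x - y‖ := NonUnitalStarAlgHom.norm_apply_le γ (x - y)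
  have e : b * γ x - γ x * b
      = (b * γ y - γ y * b) + (b * γ (x - y) - γ (x - y) * b) := by
    rw [map_sub, sub_mul, mul_sub]; abel
  have n2 := norm_mul_le b (γ (x - y))
  have n3 := norm_mul_le (γ (x - y)) b
  have n4 := norm_sub_le (b * γ (x - y)) (γ (x - y) * b)
  have n5 := norm_add_le (b * γ y - γ y * b) (b * γ (x - y) - γ (x - y) * b)
  have n6 : ‖b‖ * ‖γ (x - y)‖ ≤ ‖γ (x - y)‖ :=
    mul_le_of_le_one_left (norm_nonneg _) hb
  rw [e]
  linarith [mul_comm ‖b‖ ‖γ (x - y)‖]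

end

/-- Proposition 1.2: Let `C` be a C*-algebra, `G ⊆ C` a self-adjoint subset generating
`C` as a C*-algebra (i.e. the smallest closed subalgebra containing `G` is `C`),
`E ⊆ C` finite and `θ > 0`. Then there are `β > 0` and a finite `G' ⊆ G` such that for
every C*-algebra `B`, every *-homomorphism `γ : C → B` and every contraction `b ∈ B`:
if `‖[b, γ(g)]‖ < β` for all `g ∈ G'`, then `‖[b, γ(e)]‖ < θ` for all `e ∈ E`. -/
theorem stmt_3 {C : Type*} [NonUnitalCStarAlgebra C]
    (G : Set C) (hGstar : star '' G = G)
    (hGgen : closure (NonUnitalAlgebra.adjoin ℂ G : Set C) = Set.univ)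
    (E : Finset C) (θ : ℝ) (hθ : 0 < θ) :
    ∃ β > (0:ℝ), ∃ G' : Finset C, ↑G' ⊆ G ∧
      ∀ (B : Type*) [NonUnitalCStarAlgebra B] (γ : C →⋆ₙₐ[ℂ] B) (b : B),
        ‖b‖ ≤ 1 →
        (∀ g ∈ G', ‖b * γ g - γ g * b‖ < β) →
        ∀ e ∈ E, ‖b * γ e - γ e * b‖ < θ := by
  classical
  induction E using Finset.induction_on with
  | empty => exact ⟨1, one_pos, ∅, by simp, by simp⟩
  | insert x E _ ih =>
    obtain ⟨β₁, h₁, G₁, hG₁, H₁⟩ := ih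
    obtain ⟨β₂, h₂, G₂, hG₂, H₂⟩ :=
      ApproxCtrl.of_mem_closure (G := G) (x := x) (by rw [hGgen]; trivial) θ hθ
    refine ⟨min β₁ β₂, lt_min h₁ h₂, G₁ ∪ G₂, by simp [hG₁, hG₂], ?_⟩
    intro B _ γ b hb h e he
    rcases Finset.mem_insert.1 he with rfl | he
    · exact H₂ B γ b hb fun g hg =>
        (h g (Finset.mem_union_right _ hg)).trans_le (min_le_right _ _)
    · exact H₁ B γ b hb (fun g hg =>
        (h g (Finset.mem_union_left _ hg)).trans_le (min_le_left _ _)) e he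
end

section
/- Let X be an infinite, compact, metrizable topological space, let α : X → X be a minimal homeomorphism, and let δ > 0. Then there exist a continuous function h : X → ℝ with 0 ≤ h(x) ≤ 1 for all x ∈ X, and points x₀, x₁ ∈ X with Orb(x₀) ∩ Orb(x₁) = ∅, such that h(x₀) = 0, h(x₁) = 1, and |h(α⁻¹(x)) − h(x)| < δ for every x ∈ X. -/
theorem aux_cont {X : Type*} [TopologicalSpace X] (α : X ≃ₜ X) (k : ℤ) :
    Continuous (fun x => (α.toEquiv ^ k) x) := by
  induction k using Int.induction_on with
  | zero => simpa using continuous_id'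
  | succ n ih =>
    have : (fun x => (α.toEquiv ^ ((n : ℤ) + 1)) x) = fun x => (α.toEquiv ^ (n : ℤ)) (α x) := by
      funext x; rw [zpow_add_one]; rfl
    rw [this]; exact ih.comp α.continuous
  | pred n ih =>
    have : (fun x => (α.toEquiv ^ (-(n : ℤ) - 1)) x)
        = fun x => (α.toEquiv ^ (-(n : ℤ))) (α.symm x) := by
      funext x; rw [zpow_sub_one]; rfl
    rw [this]; exact ih.comp α.symm.continuous

theorem aux_two {X : Type*} [TopologicalSpace X] [CompactSpace X]
    [T2Space X] [Infinite X] (α : X ≃ₜ X) (y : X) :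
    ∃ z : X, ∀ n : ℤ, (α.toEquiv ^ n) y ≠ z := by
  by_contra! hc
  have : Nonempty X := ⟨y⟩
  obtain ⟨n, hn⟩ := nonempty_interior_of_iUnion_of_closed
    (f := fun n : ℤ => ({(α.toEquiv ^ n) y} : Set X)) (fun _ => isClosed_singleton)
    (by ext z; simpa [eq_comm] using hc z)
  have hop : IsOpen ({(α.toEquiv ^ n) y} : Set X) := by
    have h1 := (Set.subset_singleton_iff_eq.1
      (interior_subset (s := ({(α.toEquiv ^ n) y} : Set X)))).resolve_left hn.ne_empty
    rw [← h1]; exact isOpen_interior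
  have hall : ∀ z : X, IsOpen ({z} : Set X) := by
    intro z
    obtain ⟨m, rfl⟩ := hc z
    have h2 := hop.preimage (aux_cont α (n - m))
    convert h2 using 1
    ext w
    simp only [Set.mem_singleton_iff, Set.mem_preimage]
    have : (α.toEquiv ^ n) y = (α.toEquiv ^ (n - m)) ((α.toEquiv ^ m) y) := by
      rw [← Equiv.Perm.mul_apply, ← zpow_add]; simp
    rw [this, EmbeddingLike.apply_eq_iff_eq]
  have : DiscreteTopology X := discreteTopology_iff_isOpen_singleton.2 hall
  exact not_finite_iff_infinite.2 ‹_› finite_of_compact_of_discrete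

/-- Proposition 3.2 (commutative part): for a minimal homeomorphism `α` of an infinite
compact metrizable space and `δ > 0`, there are a continuous `h : X → [0,1]` and points
`x₀, x₁` with disjoint orbits such that `h(x₀) = 0`, `h(x₁) = 1` and
`|h ∘ α⁻¹ − h| < δ` everywhere. -/
theorem stmt_9 {X : Type*} [TopologicalSpace X] [CompactSpace X]
    [TopologicalSpace.MetrizableSpace X] [Infinite X] (α : X ≃ₜ X)
    (hmin : ∀ x : X, Dense (Set.range fun n : ℤ => (α.toEquiv ^ n) x))
    (δ : ℝ) (hδ : 0 < δ) :
    ∃ (h : C(X, ℝ)) (x₀ x₁ : X),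
      (∀ m n : ℤ, (α.toEquiv ^ n) x₁ ≠ (α.toEquiv ^ m) x₀) ∧
      (∀ x : X, 0 ≤ h x ∧ h x ≤ 1) ∧
      h x₀ = 0 ∧ h x₁ = 1 ∧
      ∀ x : X, |h (α.symm x) - h x| < δ := by
  obtain ⟨y⟩ : Nonempty X := inferInstance
  obtain ⟨z, hz⟩ := aux_two α y
  have hdis : ∀ m n : ℤ, (α.toEquiv ^ n) y ≠ (α.toEquiv ^ m) z := by
    intro m n he
    apply hz (n - m)
    have : (α.toEquiv ^ n) y = (α.toEquiv ^ m) ((α.toEquiv ^ (n - m)) y) := by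
      rw [← Equiv.Perm.mul_apply, ← zpow_add]; simp
    rw [this] at he
    exact (α.toEquiv ^ m).injective he
  obtain ⟨N0, hN0⟩ := exists_nat_one_div_lt hδ
  obtain ⟨N, hN⟩ : ∃ N : ℤ, N = (N0 : ℤ) + 1 := ⟨_, rfl⟩
  obtain ⟨ε, hε⟩ : ∃ ε : ℝ, ε = 1 / ((N0 : ℝ) + 1) := ⟨_, rfl⟩
  have hε0 : 0 < ε := by rw [hε]; positivity
  have hNε : (N : ℝ) * ε = 1 := by rw [hN, hε]; push_cast; field_simp
  have hNpos : 0 < N := by omega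
  rw [← hε] at hN0
  let S : Finset ℤ := Finset.Icc (-N) N
  have hS0 : (0 : ℤ) ∈ S := by simp [S]; omega
  have hS : S.Nonempty := ⟨0, hS0⟩
  have hfin : ((fun k : ℤ => (α.toEquiv ^ k) z) '' (S : Set ℤ)).Finite := S.finite_toSet.image _
  obtain ⟨f, hf0, hf1, hf⟩ := exists_continuous_zero_one_of_isClosed hfin.isClosed
    (isClosed_singleton (x := y)) (by
      rw [Set.disjoint_singleton_right]
      rintro ⟨k, -, hk⟩
      exact hdis k 0 (by simpa using hk.symm))
  let g : ℤ → X → ℝ := fun k x => (1 - |(k : ℝ)| * ε) * f ((α.toEquiv ^ k) x)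
  have hgc : ∀ k, Continuous (g k) := fun k =>
    continuous_const.mul (f.continuous.comp (aux_cont α k))
  have hc : ∀ k ∈ S, 0 ≤ 1 - |(k : ℝ)| * ε := by
    intro k hk
    have h1 : |k| ≤ N := abs_le.2 (Finset.mem_Icc.1 hk)
    have h2 : |(k : ℝ)| ≤ N := by exact_mod_cast h1
    nlinarith
  have hg0 : ∀ k ∈ S, ∀ x, 0 ≤ g k x := fun k hk x => mul_nonneg (hc k hk) (hf _).1
  have hg1 : ∀ k ∈ S, ∀ x, g k x ≤ 1 := fun k hk x => by
    have := mul_nonneg (abs_nonneg (k : ℝ)) hε0.le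
    exact mul_le_one₀ (by linarith) (hf _).1 (hf _).2
  let h : C(X, ℝ) := ⟨fun x => S.sup' hS (fun k => g k x),
    Continuous.finset_sup'_apply hS (fun k _ => hgc k)⟩
  have hle : ∀ k ∈ S, ∀ x, g k x ≤ h x := fun k hk x =>
    Finset.le_sup' (fun k => g k x) hk
  have hub : ∀ x c, (∀ k ∈ S, g k x ≤ c) → h x ≤ c := fun x c hh => Finset.sup'_le hS _ hh
  have h0 : ∀ x, 0 ≤ h x := fun x => (hg0 0 hS0 x).trans (hle 0 hS0 x)
  have key : ∀ x x' : X, ∀ s : ℤ, |s| = 1 →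
      (∀ k : ℤ, (α.toEquiv ^ k) x = (α.toEquiv ^ (k + s)) x') → h x ≤ h x' + ε := by
    intro x x' s hs hk
    apply hub
    intro k hkS
    by_cases hm : k + s ∈ S
    · have h1 := hle _ hm x'
      have h2 : |((k + s : ℤ) : ℝ)| ≤ |(k : ℝ)| + 1 := by
        have : |k + s| ≤ |k| + 1 := hs ▸ abs_add_le k s
        exact_mod_cast this
      have h3 := hf ((α.toEquiv ^ (k + s)) x')
      have h4 : g k x ≤ g (k + s) x' + ε := by
        simp only [g, hk k]
        have hs' : |(s : ℝ)| = 1 := by exact_mod_cast hs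
        have h5 : |((k + s : ℤ) : ℝ)| - |(k : ℝ)| ≤ 1 := by linarith
        have h6 : (|((k + s : ℤ) : ℝ)| - |(k : ℝ)|) * (ε * f ((α.toEquiv ^ (k + s)) x'))
            ≤ 1 * (ε * f ((α.toEquiv ^ (k + s)) x')) :=
          mul_le_mul_of_nonneg_right h5 (mul_nonneg hε0.le h3.1)
        have h7 : ε * f ((α.toEquiv ^ (k + s)) x') ≤ ε * 1 :=
          mul_le_mul_of_nonneg_left h3.2 hε0.le
        linarith
      linarith
    · have hkN : |k| = N := by
        simp only [S, Finset.mem_Icc] at hm hkS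
        rcases abs_cases s with h | h <;> rcases abs_cases k with h' | h' <;> omega
      have hkN' : |(k : ℝ)| = N := by exact_mod_cast hkN
      have : g k x = 0 := by simp [g, hkN', hNε]
      rw [this]; linarith [h0 x']
  refine ⟨h, z, y, hdis, fun x => ⟨h0 x, hub x 1 fun k hk => hg1 k hk x⟩, ?_, ?_, ?_⟩
  · refine le_antisymm (hub z 0 fun k hk => ?_) (h0 z)
    have : f ((α.toEquiv ^ k) z) = 0 := hf0 ⟨k, hk, rfl⟩
    simp [g, this]
  · refine le_antisymm (hub y 1 fun k hk => hg1 k hk y) ?_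
    have h1 := hle 0 hS0 y
    have : f y = 1 := hf1 rfl
    simpa [g, this] using h1
  · intro x
    have k1 := key (α.symm x) x (-1) (by simp) (fun k => by
      rw [← sub_eq_add_neg, zpow_sub_one]; rfl)
    have k2 := key x (α.symm x) 1 (by simp) (fun k => by
      rw [zpow_add_one, Equiv.Perm.mul_apply]
      congr 1
      exact (α.apply_symm_apply x).symm)
    rw [abs_lt]
    constructor <;> linarith
end

section
/- Let A be a unital C*-algebra, let u ∈ A be a unitary, let c ∈ A be a positive element with ‖c‖ ≤ 1, and let f ∈ A be an element with ‖f‖ ≤ 1 that commutes with c. Let k ≥ 1 be a natural number and let l be a natural number with 1 ≤ l ≤ k. Then ‖c·f·uˡ − c^{(2k−l)/(2k)}·f·(u·c^{1/(2k)})ˡ‖ ≤ (l(l+1)/2) · ‖u·c^{1/(2k)} − c^{1/(2k)}·u‖, where for a real exponent t ∈ (0,1] the element cᵗ is defined by the continuous functional calculus. -/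
theorem aux_comm {A : Type*} [NormedRing A] [NormOneClass A] (u d : A) (hu : ‖u‖ ≤ 1)
    (l : ℕ) : ‖d * u ^ l - u ^ l * d‖ ≤ l * ‖u * d - d * u‖ := by
  induction l with
  | zero => simp
  | succ l ih =>
    have h : d * u ^ (l + 1) - u ^ (l + 1) * d
        = (d * u ^ l - u ^ l * d) * u - u ^ l * (u * d - d * u) := by
      rw [pow_succ]; noncomm_ring
    have hp : ‖u ^ l‖ ≤ 1 := (norm_pow_le u l).trans (pow_le_one₀ (norm_nonneg _) hu)
    have h1 : ‖(d * u ^ l - u ^ l * d) * u‖ ≤ ‖d * u ^ l - u ^ l * d‖ :=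
      (norm_mul_le _ _).trans (mul_le_of_le_one_right (norm_nonneg _) hu)
    have h2 : ‖u ^ l * (u * d - d * u)‖ ≤ ‖u * d - d * u‖ :=
      (norm_mul_le _ _).trans (mul_le_of_le_one_left (norm_nonneg _) hp)
    rw [h]
    refine (norm_sub_le _ _).trans ?_
    push_cast
    linarith

theorem aux_main {A : Type*} [NormedRing A] [NormOneClass A] (u d : A) (hu : ‖u‖ ≤ 1)
    (hd : ‖d‖ ≤ 1) (l : ℕ) :
    ‖d ^ l * u ^ l - (u * d) ^ l‖ ≤ ((l : ℝ) * (l + 1) / 2) * ‖u * d - d * u‖ := by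
  induction l with
  | zero => simp
  | succ l ih =>
    have h : d ^ (l + 1) * u ^ (l + 1) - (u * d) ^ (l + 1)
        = (d ^ l * u ^ l - (u * d) ^ l) * (u * d)
          + d ^ l * (d * u ^ (l + 1) - u ^ (l + 1) * d) := by
      rw [pow_succ d, pow_succ u, pow_succ (u * d)]; noncomm_ring
    have hp : ‖d ^ l‖ ≤ 1 := (norm_pow_le d l).trans (pow_le_one₀ (norm_nonneg _) hd)
    have hud : ‖u * d‖ ≤ 1 :=
      (norm_mul_le _ _).trans (mul_le_one₀ hu (norm_nonneg _) hd)
    have h1 := (norm_mul_le (d ^ l * u ^ l - (u * d) ^ l) (u * d)).trans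
      (mul_le_of_le_one_right (norm_nonneg _) hud)
    have h2 := (norm_mul_le (d ^ l) (d * u ^ (l + 1) - u ^ (l + 1) * d)).trans
      (mul_le_of_le_one_left (norm_nonneg _) hp)
    have h3 := aux_comm u d hu (l + 1)
    rw [h]
    refine (norm_add_le _ _).trans ?_
    push_cast at h3 ⊢
    linarith

/-- The commutator estimate used in the proof of Theorem 4.4: in a unital C*-algebra,
for a unitary `u`, a positive contraction `c`, a contraction `f` commuting with `c`,
and natural numbers `1 ≤ l ≤ k`,
`‖c·f·uˡ − c^{(2k−l)/(2k)}·f·(u·c^{1/(2k)})ˡ‖ ≤ (l(l+1)/2)·‖[u, c^{1/(2k)}]‖`,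
where real powers of `c` are taken via the continuous functional calculus. -/
theorem stmt_15 {A : Type*} [CStarAlgebra A] [PartialOrder A] [StarOrderedRing A]
    (u : A) (hu : u ∈ unitary A)
    (c : A) (hc : 0 ≤ c) (hc1 : ‖c‖ ≤ 1)
    (f : A) (hf : ‖f‖ ≤ 1) (hcf : Commute c f)
    (k l : ℕ) (hk : 1 ≤ k) (hl : 1 ≤ l) (hlk : l ≤ k) :
    ‖c * f * u ^ l -
        cfc (fun x : ℝ => x ^ ((2 * (k : ℝ) - l) / (2 * k))) c * f *
          (u * cfc (fun x : ℝ => x ^ (1 / (2 * (k : ℝ)))) c) ^ l‖ ≤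
      ((l : ℝ) * (l + 1) / 2) *
        ‖u * cfc (fun x : ℝ => x ^ (1 / (2 * (k : ℝ)))) c -
          cfc (fun x : ℝ => x ^ (1 / (2 * (k : ℝ)))) c * u‖ := by
  rcases subsingleton_or_nontrivial A with hA | hA
  · rw [norm_of_subsingleton, norm_of_subsingleton]
    simp
  have hk0 : (0 : ℝ) < 2 * k := by
    have : (1 : ℝ) ≤ k := by exact_mod_cast hk
    linarith
  have hlk' : (l : ℝ) ≤ k := by exact_mod_cast hlk
  have hu1 : ‖u‖ ≤ 1 := (CStarRing.norm_of_mem_unitary hu).le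
  have hsa : IsSelfAdjoint c := IsSelfAdjoint.of_nonneg hc
  have hspec : ∀ x ∈ spectrum ℝ c, 0 ≤ x ∧ x ≤ 1 := fun x hx =>
    ⟨spectrum_nonneg_of_nonneg hc hx,
      (le_abs_self x).trans ((spectrum.norm_le_norm_of_mem hx).trans hc1)⟩
  have hcont : ∀ t : ℝ, 0 ≤ t → Continuous (fun x : ℝ => x ^ t) := fun t ht =>
    Real.continuous_rpow_const ht
  have hnorm : ∀ t : ℝ, 0 ≤ t → ‖cfc (fun x : ℝ => x ^ t) c‖ ≤ 1 := by
    intro t ht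
    refine norm_cfc_le zero_le_one fun x hx => ?_
    obtain ⟨h0, h1⟩ := hspec x hx
    rw [Real.norm_of_nonneg (Real.rpow_nonneg h0 t)]
    exact Real.rpow_le_one h0 h1 ht
  have ht0 : 0 ≤ 1 / (2 * (k : ℝ)) := by positivity
  have hs0 : 0 ≤ (2 * (k : ℝ) - l) / (2 * k) := div_nonneg (by linarith) hk0.le
  have hd1 := hnorm _ ht0
  have he1 := hnorm _ hs0
  have hdf : Commute (cfc (fun x : ℝ => x ^ (1 / (2 * (k : ℝ)))) c) f := hsa.commute_cfc hcf _
  have hce : c = cfc (fun x : ℝ => x ^ ((2 * (k : ℝ) - l) / (2 * k))) c *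
      cfc (fun x : ℝ => x ^ (1 / (2 * (k : ℝ)))) c ^ l := by
    rw [← cfc_pow _ l c (hcont _ ht0).continuousOn hsa,
      ← cfc_mul _ _ c (hcont _ hs0).continuousOn (show Continuous (fun x : ℝ => (x ^ (1 / (2 * (k : ℝ)))) ^ l) from
        (hcont _ ht0).pow l).continuousOn]
    conv_lhs => rw [← cfc_id' ℝ c hsa]
    refine cfc_congr fun x hx => ?_
    obtain ⟨h0, -⟩ := hspec x hx
    have hl0 : (0 : ℝ) ≤ l := Nat.cast_nonneg l
    rw [← Real.rpow_natCast, ← Real.rpow_mul h0,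
      ← Real.rpow_add_of_nonneg h0 hs0 (by positivity)]
    have : (2 * (k : ℝ) - l) / (2 * k) + 1 / (2 * k) * l = 1 := by
      field_simp; ring
    rw [this, Real.rpow_one]
  generalize cfc (fun x : ℝ => x ^ ((2 * (k : ℝ) - l) / (2 * k))) c = e at *
  generalize cfc (fun x : ℝ => x ^ (1 / (2 * (k : ℝ)))) c = d at *
  have hdl : d ^ l * f = f * d ^ l := (hdf.pow_left l).eq
  have key : c * f * u ^ l - e * f * (u * d) ^ l
      = e * f * (d ^ l * u ^ l - (u * d) ^ l) := by
    rw [hce, mul_assoc e, hdl]; noncomm_ring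
  rw [key]
  have hef : ‖e * f‖ ≤ 1 := (norm_mul_le _ _).trans (mul_le_one₀ he1 (norm_nonneg _) hf)
  exact (norm_mul_le _ _).trans ((mul_le_of_le_one_left (norm_nonneg _) hef).trans
    (aux_main u d hu1 hd1 l))
end
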